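/- Let b₁, …, b₆ : ℝ → ℝ be functions. Let (U₁, S₁, ν₁, T₁, P₁) be a differentiable solution of the thermodynamic system dU/dt = −(b₁ − b₆)U + b₃ν + b₅S, dS/dt = b₆S, dν/dt = b₂U + (b₁ + b₆)ν + b₄S, dT/dt = −b₁T + b₂TP + b₄P + b₅, dP/dt = b₂P² − 2b₁P − b₃, and let (U₂, S₂, ν₂, T₂, P₂) be a differentiable solution of its sl(2,ℝ)-part dU/dt = −b₁U + b₃ν, dS/dt = 0, dν/dt = b₂U + b₁ν, dT/dt = −b₁T + b₂TP, dP/dt = b₂P² − 2b₁P − b₃. Set G_i = U_i + P_iν_i − S_iT_i and assume S₁(t), S₂(t), G₁(t), G₂(t) are nonzero for all t. Then the functions I₁(t) = S₁(U₂ + P₁ν₂)/(S₂G₁) and I₂(t) = S₁S₂(P₁ − P₂)/(G₁G₂) are constant on ℝ. -/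

import Mathlib

/-- Two solutions of the same scalar linear equation `x' = a x` have a constant ratio. -/
theorem div_eq_div_of_hasDerivAt_mul {a f g : ℝ → ℝ}
    (hf : ∀ t, HasDerivAt f (a t * f t) t) (hg : ∀ t, HasDerivAt g (a t * g t) t)
    (hg0 : ∀ t, g t ≠ 0) (s t : ℝ) : f s / g s = f t / g t := by
  have h : ∀ x, HasDerivAt (fun y => f y / g y) 0 x := fun x =>
    ((hf x).fun_div (hg x) (hg0 x)).congr_deriv (by ring)
  exact is_const_of_deriv_eq_zero (fun x => (h x).differentiableAt) (fun x => (h x).deriv) s t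

/-- Along the thermodynamic system the Gibbs free energy `U + Pν - ST` solves the scalar linear
equation with coefficient `b₂P - b₁ + b₆`. -/
theorem hasDerivAt_gibbs {b1 b2 b3 b4 b5 b6 t : ℝ} {U S nu T P : ℝ → ℝ}
    (hU : HasDerivAt U (-(b1 - b6) * U t + b3 * nu t + b5 * S t) t)
    (hS : HasDerivAt S (b6 * S t) t)
    (hnu : HasDerivAt nu (b2 * U t + (b1 + b6) * nu t + b4 * S t) t)
    (hT : HasDerivAt T (-b1 * T t + b2 * T t * P t + b4 * P t + b5) t)
    (hP : HasDerivAt P (b2 * P t ^ 2 - 2 * b1 * P t - b3) t) :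
    HasDerivAt (fun x => U x + P x * nu x - S x * T x)
      ((b2 * P t - b1 + b6) * (U t + P t * nu t - S t * T t)) t :=
  ((hU.fun_add (hP.fun_mul hnu)).fun_sub (hS.fun_mul hT)).congr_deriv (by ring)

/-- The functions `I₁ = S₁(U₂ + P₁ν₂)/(S₂G₁)` and `I₂ = S₁S₂(P₁ − P₂)/(G₁G₂)` are constants of
motion of the direct product of the thermodynamic Lie system and its `sl(2,ℝ)`-part, where
`G_i = U_i + P_iν_i − S_iT_i` is the Gibbs free energy. -/
theorem thermodynamic_constants_of_motion
    (b1 b2 b3 b4 b5 b6 : ℝ → ℝ)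
    (U1 S1 nu1 T1 P1 U2 S2 nu2 T2 P2 : ℝ → ℝ)
    (hU1 : ∀ t, HasDerivAt U1 (-(b1 t - b6 t) * U1 t + b3 t * nu1 t + b5 t * S1 t) t)
    (hS1 : ∀ t, HasDerivAt S1 (b6 t * S1 t) t)
    (hnu1 : ∀ t, HasDerivAt nu1 (b2 t * U1 t + (b1 t + b6 t) * nu1 t + b4 t * S1 t) t)
    (hT1 : ∀ t, HasDerivAt T1 (-(b1 t) * T1 t + b2 t * T1 t * P1 t + b4 t * P1 t + b5 t) t)
    (hP1 : ∀ t, HasDerivAt P1 (b2 t * P1 t ^ 2 - 2 * b1 t * P1 t - b3 t) t)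
    (hU2 : ∀ t, HasDerivAt U2 (-(b1 t) * U2 t + b3 t * nu2 t) t)
    (hS2 : ∀ t, HasDerivAt S2 (0 : ℝ) t)
    (hnu2 : ∀ t, HasDerivAt nu2 (b2 t * U2 t + b1 t * nu2 t) t)
    (hT2 : ∀ t, HasDerivAt T2 (-(b1 t) * T2 t + b2 t * T2 t * P2 t) t)
    (hP2 : ∀ t, HasDerivAt P2 (b2 t * P2 t ^ 2 - 2 * b1 t * P2 t - b3 t) t)
    (hS1ne : ∀ t, S1 t ≠ 0) (hS2ne : ∀ t, S2 t ≠ 0)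
    (hG1ne : ∀ t, U1 t + P1 t * nu1 t - S1 t * T1 t ≠ 0)
    (hG2ne : ∀ t, U2 t + P2 t * nu2 t - S2 t * T2 t ≠ 0) :
    (∀ s t : ℝ,
        S1 s * (U2 s + P1 s * nu2 s) / (S2 s * (U1 s + P1 s * nu1 s - S1 s * T1 s))
          = S1 t * (U2 t + P1 t * nu2 t) / (S2 t * (U1 t + P1 t * nu1 t - S1 t * T1 t))) ∧
      (∀ s t : ℝ,
        S1 s * S2 s * (P1 s - P2 s)
            / ((U1 s + P1 s * nu1 s - S1 s * T1 s) * (U2 s + P2 s * nu2 s - S2 s * T2 s))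
          = S1 t * S2 t * (P1 t - P2 t)
            / ((U1 t + P1 t * nu1 t - S1 t * T1 t) * (U2 t + P2 t * nu2 t - S2 t * T2 t))) := by
  have hG1 := fun t => hasDerivAt_gibbs (hU1 t) (hS1 t) (hnu1 t) (hT1 t) (hP1 t)
  have hG2 := fun t => hasDerivAt_gibbs (b1 := b1 t) (b2 := b2 t) (b3 := b3 t) (b4 := 0)
    (b5 := 0) (b6 := 0) ((hU2 t).congr_deriv (by ring)) ((hS2 t).congr_deriv (by ring))
    ((hnu2 t).congr_deriv (by ring)) ((hT2 t).congr_deriv (by ring)) (hP2 t)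
  constructor
  · refine div_eq_div_of_hasDerivAt_mul (a := fun t => b2 t * P1 t - b1 t + b6 t)
      (f := fun t => S1 t * (U2 t + P1 t * nu2 t))
      (g := fun t => S2 t * (U1 t + P1 t * nu1 t - S1 t * T1 t))
      (fun t => ?_) (fun t => ?_) (fun t => mul_ne_zero (hS2ne t) (hG1ne t))
    · exact ((hS1 t).fun_mul ((hU2 t).fun_add ((hP1 t).fun_mul (hnu2 t)))).congr_deriv (by ring)
    · exact ((hS2 t).fun_mul (hG1 t)).congr_deriv (by ring)
  · refine div_eq_div_of_hasDerivAt_mul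
      (a := fun t => b2 t * (P1 t + P2 t) - 2 * b1 t + b6 t)
      (f := fun t => S1 t * S2 t * (P1 t - P2 t))
      (g := fun t => (U1 t + P1 t * nu1 t - S1 t * T1 t) * (U2 t + P2 t * nu2 t - S2 t * T2 t))
      (fun t => ?_) (fun t => ?_) (fun t => mul_ne_zero (hG1ne t) (hG2ne t))
    · exact (((hS1 t).fun_mul (hS2 t)).fun_mul ((hP1 t).fun_sub (hP2 t))).congr_deriv (by ring)
    · exact ((hG1 t).fun_mul (hG2 t)).congr_deriv (by ring)
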